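/- arXiv:2204.02690 — 3 statements merged into one kernel-verified Lean document; each statement's English description precedes it below -/
import Mathlib

section
/- Assume 0 < γ < 2(m + α(1 − w_d) + ε)/(M + ε + α(1 − w_m) + α(1 − w_d)) and σ(𝕋_γ) > 0. Fix g ∈ ℝ^{nN}, let d^0 = 0 and d^{ℓ+1} = 𝕋_γ d^ℓ − γ 𝔻^{-1} g for ℓ = 0, 1, 2, …. Set c := ((M + 2α + ε)/(m + ε)) · √((ε + M + α(1 − w_m))/(ε + m + α(1 − w_d))). Then for every η > 0 and every ℓ ∈ ℕ with ℓ ≥ ln(c/η)/ln(1/σ(𝕋_γ)), it holds that ‖ℍ d^ℓ + g‖ ≤ η ‖g‖. -/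
open scoped Kronecker RealInnerProductSpace
open Filter Topology

/-- Spectral norm (ℓ2 operator norm) of a real square matrix. -/
noncomputable def specNorm {ι : Type*} [Fintype ι] [DecidableEq ι] (A : Matrix ι ι ℝ) : ℝ :=
  ‖Matrix.toEuclideanCLM (𝕜 := ℝ) A‖

/-- Action of a matrix on a vector of Euclidean space. -/
noncomputable def mApp {ι : Type*} [Fintype ι] [DecidableEq ι]
    (A : Matrix ι ι ℝ) (x : EuclideanSpace ℝ ι) : EuclideanSpace ℝ ι :=
  Matrix.toEuclideanCLM (𝕜 := ℝ) A x

/-- Spectral radius of a real square matrix (computed over ℂ). -/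
noncomputable def specRad {ι : Type*} [Fintype ι] [DecidableEq ι] (A : Matrix ι ι ℝ) : ℝ :=
  (spectralRadius ℂ (A.map (Complex.ofReal : ℝ → ℂ))).toReal

/-- The matrix 𝕎 = W ⊗ Iₙ. -/
noncomputable def WW (N n : ℕ) (W : Matrix (Fin N) (Fin N) ℝ) :
    Matrix (Fin N × Fin n) (Fin N × Fin n) ℝ :=
  Matrix.kroneckerMap (· * ·) W (1 : Matrix (Fin n) (Fin n) ℝ)

/-- The i-th block component xᵢ ∈ ℝⁿ of x ∈ ℝ^{nN}. -/
noncomputable def comp (N n : ℕ) (x : EuclideanSpace ℝ (Fin N × Fin n)) (i : Fin N) :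
    EuclideanSpace ℝ (Fin n) :=
  (EuclideanSpace.equiv (Fin n) ℝ).symm fun j => x (i, j)

/-- The block-diagonal Hessian ∇²f(x) of f(x) = Σᵢ fᵢ(xᵢ), from local Hessians HF i. -/
noncomputable def blockHess (N n : ℕ)
    (HF : Fin N → EuclideanSpace ℝ (Fin n) → Matrix (Fin n) (Fin n) ℝ)
    (x : EuclideanSpace ℝ (Fin N × Fin n)) :
    Matrix (Fin N × Fin n) (Fin N × Fin n) ℝ :=
  Matrix.of fun p q =>
    if p.1 = q.1 then HF p.1 (comp N n x p.1) p.2 q.2 else 0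

/-- The block norm ‖𝕋‖_b = max_i Σ_j ‖T_{ij}‖₂. -/
noncomputable def blockNorm {N n : ℕ} (T : Matrix (Fin N × Fin n) (Fin N × Fin n) ℝ) : ℝ :=
  ⨆ i : Fin N, ∑ j : Fin N, specNorm (Matrix.of fun (a b : Fin n) => T (i, a) (j, b))

section Euclidean

variable {ι : Type*} [Fintype ι] [DecidableEq ι]

lemma mApp_ofLp (A : Matrix ι ι ℝ) (x : EuclideanSpace ℝ ι) :
    (mApp A x).ofLp = A.mulVec x.ofLp :=
  Matrix.ofLp_toEuclideanCLM A x

lemma mApp_diagonal_apply (v : ι → ℝ) (x : EuclideanSpace ℝ ι) (i : ι) :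
    mApp (Matrix.diagonal v) x i = v i * x i := by
  rw [mApp_ofLp, Matrix.mulVec_diagonal]

lemma mApp_mul (A B : Matrix ι ι ℝ) (x : EuclideanSpace ℝ ι) :
    mApp (A * B) x = mApp A (mApp B x) := by
  simp [mApp]

lemma norm_mApp_diagonal_le {v : ι → ℝ} {K : ℝ} (hK : 0 ≤ K) (hv : ∀ i, |v i| ≤ K)
    (x : EuclideanSpace ℝ ι) : ‖mApp (Matrix.diagonal v) x‖ ≤ K * ‖x‖ := by
  refine le_of_sq_le_sq ?_ (by positivity)
  rw [mul_pow, EuclideanSpace.norm_sq_eq, EuclideanSpace.norm_sq_eq, Finset.mul_sum]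
  refine Finset.sum_le_sum fun i _ => ?_
  rw [mApp_diagonal_apply, norm_mul, mul_pow, Real.norm_eq_abs]
  have := hv i
  gcongr

lemma specRad_units_conjugate (u : (Matrix ι ι ℝ)ˣ) (A : Matrix ι ι ℝ) :
    specRad ((u : Matrix ι ι ℝ) * A * ((u⁻¹ : (Matrix ι ι ℝ)ˣ) : Matrix ι ι ℝ)) = specRad A := by
  have h := spectrum.units_conjugate (R := ℂ)
    (a := A.map (Complex.ofReal : ℝ → ℂ))
    (u := Units.map (Complex.ofRealHom.mapMatrix (m := ι)).toMonoidHom u)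
  have e : ((u : Matrix ι ι ℝ) * A * ((u⁻¹ : (Matrix ι ι ℝ)ˣ) : Matrix ι ι ℝ)).map (Complex.ofReal : ℝ → ℂ) =
      (Complex.ofRealHom.mapMatrix (m := ι))
        ((u : Matrix ι ι ℝ) * A * ((u⁻¹ : (Matrix ι ι ℝ)ˣ) : Matrix ι ι ℝ)) := rfl
  unfold specRad spectralRadius
  rw [e, map_mul, map_mul, ← h]
  rfl

section L2

open scoped Matrix.Norms.L2Operator

lemma isSelfAdjoint_map_ofReal {κ : Type*} {A : Matrix κ κ ℝ} (hA : A.IsSymm) :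
    IsSelfAdjoint (A.map (Complex.ofReal : ℝ → ℂ)) := by
  ext i j
  simp [Matrix.star_apply, hA.apply i j]

lemma norm_mApp_le_specRad_mul {A : Matrix ι ι ℝ} (hA : A.IsSymm) (x : EuclideanSpace ℝ ι) :
    ‖mApp A x‖ ≤ specRad A * ‖x‖ := by
  have hr : specRad A = ‖A.map (Complex.ofReal : ℝ → ℂ)‖ := by
    rw [specRad, (isSelfAdjoint_map_ofReal hA).spectralRadius_eq_nnnorm]
    rfl
  have hn : ∀ y : EuclideanSpace ℝ ι,
      ‖(WithLp.toLp 2 (fun i => (y i : ℂ)) : EuclideanSpace ℂ ι)‖ = ‖y‖ := fun y => by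
    simp [EuclideanSpace.norm_eq]
  have h := Matrix.l2_opNorm_mulVec (A.map (Complex.ofReal : ℝ → ℂ))
    (WithLp.toLp 2 (fun i => (x i : ℂ)) : EuclideanSpace ℂ ι)
  rw [hn, ← hr] at h
  refine le_trans (le_of_eq ?_) h
  rw [← hn]
  congr 1
  ext i
  simp [mApp_ofLp, Matrix.mulVec, dotProduct]

lemma specRad_lt_one [Nonempty ι] {A : Matrix ι ι ℝ} (hA : A.IsSymm)
    (h : ∀ (r : ℝ) (v : ι → ℝ), v ≠ 0 → A.mulVec v = r • v → |r| < 1) : specRad A < 1 := by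
  have key : ∀ z ∈ spectrum ℂ (A.map (Complex.ofReal : ℝ → ℂ)), ‖z‖₊ < 1 := by
    intro z hz
    have hre := (isSelfAdjoint_map_ofReal hA).mem_spectrum_eq_re hz
    rw [spectrum.mem_iff, Matrix.isUnit_iff_isUnit_det, isUnit_iff_ne_zero, not_not] at hz
    have e : algebraMap ℂ (Matrix ι ι ℂ) z - A.map (Complex.ofReal : ℝ → ℂ) =
        Complex.ofRealHom.mapMatrix (algebraMap ℝ (Matrix ι ι ℝ) z.re - A) := by
      ext i j
      rw [hre]
      by_cases hij : i = j <;> simp [Matrix.algebraMap_matrix_apply, hij]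
    rw [e, ← RingHom.map_det, map_eq_zero, ← Matrix.exists_mulVec_eq_zero_iff] at hz
    obtain ⟨v, hv0, hv⟩ := hz
    have := h z.re v hv0 (by
      rw [Matrix.sub_mulVec, sub_eq_zero, Matrix.algebraMap_eq_diagonal] at hv
      rw [← hv]
      ext i
      simp [Matrix.mulVec_diagonal])
    rw [← NNReal.coe_lt_coe, coe_nnnorm, hre, Complex.norm_real]
    exact this
  have := spectrum.spectralRadius_lt_of_forall_lt _ key
  simpa [specRad] using (ENNReal.toReal_lt_toReal this.ne_top ENNReal.coe_ne_top).2 this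

end L2

/-- A relaxed Jacobi iteration for a symmetric system `H d + g = 0` with diagonal
preconditioner `diagonal d`: contraction, and decay of the residual. -/
theorem relaxedJacobi_residual [Nonempty ι] {H : Matrix ι ι ℝ} (hH : H.IsSymm)
    (hpos : ∀ v : ι → ℝ, v ≠ 0 → 0 < v ⬝ᵥ H.mulVec v) {d : ι → ℝ} {a b γ : ℝ} (ha : 0 < a)
    (hda : ∀ i, a ≤ d i) (hdb : ∀ i, d i ≤ b) (hγ : 0 < γ)
    (hlt : ∀ v : ι → ℝ, v ≠ 0 → γ * (v ⬝ᵥ H.mulVec v) < 2 * ∑ i, d i * v i ^ 2)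
    {T : Matrix ι ι ℝ} (hT : T = 1 - γ • ((Matrix.diagonal d)⁻¹ * H))
    {g : EuclideanSpace ℝ ι} {u : ℕ → EuclideanSpace ℝ ι} (hu0 : u 0 = 0)
    (hu : ∀ k, u (k + 1) = mApp T (u k) - γ • mApp (Matrix.diagonal d)⁻¹ g) :
    specRad T < 1 ∧
      ∀ k, ‖mApp H (u k) + g‖ ≤ Real.sqrt (b / a) * specRad T ^ k * ‖g‖ := by
  have hd : ∀ i, 0 < d i := fun i => ha.trans_le (hda i)
  have hb : 0 < b := (hd (Classical.arbitrary ι)).trans_le (hdb _)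
  set s : ι → ℝ := fun i => Real.sqrt (d i) with hs
  have hs0 : ∀ i, 0 < s i := fun i => Real.sqrt_pos.2 (hd i)
  set P : Matrix ι ι ℝ := Matrix.diagonal s with hP
  set Q : Matrix ι ι ℝ := Matrix.diagonal (fun i => (s i)⁻¹) with hQ
  have hPQ : P * Q = 1 := by
    rw [hP, hQ, Matrix.diagonal_mul_diagonal, ← Matrix.diagonal_one]
    congr 1; ext i; exact mul_inv_cancel₀ (hs0 i).ne'
  have hQP : Q * P = 1 := mul_eq_one_comm.1 hPQ
  have hPP : P * P = Matrix.diagonal d := by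
    rw [hP, Matrix.diagonal_mul_diagonal]
    congr 1; ext i; exact Real.mul_self_sqrt (hd i).le
  have hDinv : (Matrix.diagonal d)⁻¹ = Q * Q := by
    refine Matrix.inv_eq_right_inv ?_
    rw [← hPP, Matrix.mul_assoc, ← Matrix.mul_assoc P Q Q, hPQ, Matrix.one_mul, hPQ]
  set B : Matrix ι ι ℝ := 1 - γ • (Q * H * Q) with hB
  have hBsymm : B.IsSymm := by
    rw [hB, Matrix.IsSymm]
    simp [Matrix.transpose_mul, hQ, hH.eq, Matrix.mul_assoc]
  have hTB : T = Q * B * P := by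
    rw [hT, hDinv, hB, Matrix.mul_sub, Matrix.sub_mul, Matrix.mul_one, hQP, Matrix.mul_smul,
      Matrix.smul_mul]
    simp only [Matrix.mul_assoc, hQP, Matrix.mul_one]
  have hσ : specRad T = specRad B := by
    rw [hTB]
    exact specRad_units_conjugate ⟨Q, P, hQP, hPQ⟩ B
  refine ⟨?_, ?_⟩
  · rw [hσ]
    refine specRad_lt_one hBsymm fun r v hv hr => ?_
    set y := Q.mulVec v with hy
    have hvy : P.mulVec y = v := by rw [hy, Matrix.mulVec_mulVec, hPQ, Matrix.one_mulVec]
    have hy0 : y ≠ 0 := by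
      intro h0
      rw [h0, Matrix.mulVec_zero] at hvy
      exact hv hvy.symm
    have hvv : v ⬝ᵥ v = ∑ i, d i * y i ^ 2 := by
      rw [← hvy]
      refine Finset.sum_congr rfl fun i _ => ?_
      rw [hP, Matrix.mulVec_diagonal]
      have : s i * s i = d i := Real.mul_self_sqrt (hd i).le
      rw [← this]; ring
    have hvv0 : 0 < v ⬝ᵥ v := by
      rw [hvv]
      obtain ⟨i, hi⟩ := Function.ne_iff.1 hy0
      exact Finset.sum_pos' (fun j _ => mul_nonneg (hd j).le (sq_nonneg _))
        ⟨i, Finset.mem_univ i, mul_pos (hd i) (sq_pos_of_ne_zero hi)⟩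
    have hquad : v ⬝ᵥ (Q * H * Q).mulVec v = y ⬝ᵥ H.mulVec y := by
      rw [Matrix.mul_assoc, ← Matrix.mulVec_mulVec, ← Matrix.mulVec_mulVec, ← hy,
        Matrix.dotProduct_mulVec, ← Matrix.mulVec_transpose]
      simp [hQ, hy]
    have hrv : r * (v ⬝ᵥ v) = v ⬝ᵥ v - γ * (y ⬝ᵥ H.mulVec y) := by
      rw [← hquad, ← smul_eq_mul, ← dotProduct_smul, ← hr, hB, Matrix.sub_mulVec,
        Matrix.one_mulVec, dotProduct_sub, Matrix.smul_mulVec, dotProduct_smul, smul_eq_mul]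
    have h1 := mul_pos hγ (hpos y hy0)
    have h2 := hlt y hy0
    rw [← hvv] at h2
    rw [abs_lt]
    constructor <;> nlinarith
  · intro k
    have hy : ∀ k, ‖mApp Q (mApp H (u k) + g)‖ ≤ specRad T ^ k * ‖mApp Q g‖ := by
      intro k
      induction k with
      | zero => simp [hu0, mApp]
      | succ k ih =>
        have hstep : mApp Q (mApp H (u (k + 1)) + g) = mApp B (mApp Q (mApp H (u k) + g)) := by
          rw [hu, hT, hDinv, hB]
          simp only [mApp, map_add, map_sub, map_mul, map_smul, map_one,
            sub_apply, smul_apply, mul_apply_eq_comp, one_apply_eq_self]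
          module
        rw [hstep, pow_succ', mul_assoc]
        refine (norm_mApp_le_specRad_mul hBsymm _).trans ?_
        rw [hσ] at ih ⊢
        exact mul_le_mul_of_nonneg_left ih ENNReal.toReal_nonneg
    have hr : mApp H (u k) + g = mApp P (mApp Q (mApp H (u k) + g)) := by
      rw [← mApp_mul, hPQ]; simp [mApp]
    have hPle : ∀ z, ‖mApp P z‖ ≤ Real.sqrt b * ‖z‖ :=
      norm_mApp_diagonal_le (Real.sqrt_nonneg _) fun i => by
        rw [abs_of_pos (hs0 i)]; exact Real.sqrt_le_sqrt (hdb i)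
    have hQle : ∀ z, ‖mApp Q z‖ ≤ (Real.sqrt a)⁻¹ * ‖z‖ :=
      norm_mApp_diagonal_le (by positivity) fun i => by
        rw [abs_of_pos (inv_pos.2 (hs0 i))]
        exact inv_anti₀ (Real.sqrt_pos.2 ha) (Real.sqrt_le_sqrt (hda i))
    have hσ0 : 0 ≤ specRad T := ENNReal.toReal_nonneg
    calc ‖mApp H (u k) + g‖ ≤ Real.sqrt b * (specRad T ^ k * ((Real.sqrt a)⁻¹ * ‖g‖)) := by
          rw [hr]
          refine (hPle _).trans ?_
          gcongr
          exact (hy k).trans (by gcongr; exact hQle g)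
      _ = Real.sqrt (b / a) * specRad T ^ k * ‖g‖ := by
          rw [Real.sqrt_div hb.le]; ring

end Euclidean

section Network

/-- The Laplacian `1 - W` of a symmetric stochastic matrix is bounded below by `0` and above by
twice its diagonal. -/
lemma stochastic_quadratic_bounds {ι : Type*} [Fintype ι] [DecidableEq ι] {W : Matrix ι ι ℝ}
    (hW : W.IsSymm) (hnonneg : ∀ i j, 0 ≤ W i j) (hrow : ∀ i, ∑ j, W i j = 1) (z : ι → ℝ) :
    0 ≤ ∑ i, z i ^ 2 - ∑ i, ∑ j, W i j * z i * z j ∧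
      ∑ i, z i ^ 2 - ∑ i, ∑ j, W i j * z i * z j ≤ ∑ i, 2 * (1 - W i i) * z i ^ 2 := by
  have h1 : ∑ i, ∑ j, W i j * z i ^ 2 = ∑ i, z i ^ 2 := by
    simp [← Finset.sum_mul, hrow]
  have h2 : ∑ i, ∑ j, W i j * z j ^ 2 = ∑ i, z i ^ 2 := by
    rw [Finset.sum_comm, ← h1]
    refine Finset.sum_congr rfl fun i _ => Finset.sum_congr rfl fun j _ => ?_
    rw [hW.apply]
  constructor
  · have h : 0 ≤ ∑ i, ∑ j, W i j * (z i - z j) ^ 2 :=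
      Finset.sum_nonneg fun i _ => Finset.sum_nonneg fun j _ =>
        mul_nonneg (hnonneg i j) (sq_nonneg _)
    have e : ∑ i, ∑ j, W i j * (z i - z j) ^ 2 = ∑ i, ∑ j, W i j * z i ^ 2 +
        ∑ i, ∑ j, W i j * z j ^ 2 - 2 * ∑ i, ∑ j, W i j * z i * z j := by
      simp only [Finset.mul_sum, ← Finset.sum_add_distrib, ← Finset.sum_sub_distrib]
      exact Finset.sum_congr rfl fun i _ => Finset.sum_congr rfl fun j _ => by ring
    linarith
  · have h : ∑ i, W i i * (z i + z i) ^ 2 ≤ ∑ i, ∑ j, W i j * (z i + z j) ^ 2 :=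
      Finset.sum_le_sum fun i _ =>
        Finset.single_le_sum (f := fun j => W i j * (z i + z j) ^ 2)
          (fun j _ => mul_nonneg (hnonneg i j) (sq_nonneg _)) (Finset.mem_univ i)
    have e : ∑ i, ∑ j, W i j * (z i + z j) ^ 2 = ∑ i, ∑ j, W i j * z i ^ 2 +
        ∑ i, ∑ j, W i j * z j ^ 2 + 2 * ∑ i, ∑ j, W i j * z i * z j := by
      simp only [Finset.mul_sum, ← Finset.sum_add_distrib]
      exact Finset.sum_congr rfl fun i _ => Finset.sum_congr rfl fun j _ => by ring
    have e2 : ∑ i, W i i * (z i + z i) ^ 2 =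
        4 * ∑ i, z i ^ 2 - 2 * ∑ i, 2 * (1 - W i i) * z i ^ 2 := by
      simp only [Finset.mul_sum, ← Finset.sum_sub_distrib]
      exact Finset.sum_congr rfl fun i _ => by ring
    linarith

lemma posSemidef_quadratic_bounds {ι : Type*} [Fintype ι] [DecidableEq ι] {A : Matrix ι ι ℝ}
    {m M : ℝ} (hlow : (A - m • (1 : Matrix ι ι ℝ)).PosSemidef)
    (hup : (M • (1 : Matrix ι ι ℝ) - A).PosSemidef) (z : ι → ℝ) :
    m * ∑ i, z i ^ 2 ≤ z ⬝ᵥ A.mulVec z ∧ z ⬝ᵥ A.mulVec z ≤ M * ∑ i, z i ^ 2 := by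
  have h1 := hlow.dotProduct_mulVec_nonneg z
  have h2 := hup.dotProduct_mulVec_nonneg z
  have e : z ⬝ᵥ z = ∑ i, z i ^ 2 := Finset.sum_congr rfl fun i _ => by ring
  simp only [star_trivial, Matrix.sub_mulVec, Matrix.smul_mulVec, Matrix.one_mulVec,
    dotProduct_sub, dotProduct_smul, smul_eq_mul, e] at h1 h2
  constructor <;> linarith

variable {N n : ℕ}

lemma dotProduct_blockHess_mulVec
    (HF : Fin N → EuclideanSpace ℝ (Fin n) → Matrix (Fin n) (Fin n) ℝ)
    (x : EuclideanSpace ℝ (Fin N × Fin n)) (v : Fin N × Fin n → ℝ) :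
    v ⬝ᵥ (blockHess N n HF x).mulVec v =
      ∑ i, (fun a => v (i, a)) ⬝ᵥ (HF i (comp N n x i)).mulVec (fun a => v (i, a)) := by
  simp [dotProduct, Matrix.mulVec, blockHess, Fintype.sum_prod_type, ite_mul,
    Finset.sum_ite_irrel]

lemma dotProduct_WW_mulVec (W : Matrix (Fin N) (Fin N) ℝ) (v : Fin N × Fin n → ℝ) :
    v ⬝ᵥ (WW N n W).mulVec v = ∑ a, ∑ i, ∑ j, W i j * v (i, a) * v (j, a) := by
  rw [Finset.sum_comm]
  simp only [dotProduct, Matrix.mulVec, WW, Fintype.sum_prod_type, Matrix.kroneckerMap_apply,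
    Matrix.one_apply, mul_ite, mul_one, mul_zero, ite_mul, zero_mul, Finset.sum_ite_eq,
    Finset.mem_univ, if_true, Finset.mul_sum]
  exact Finset.sum_congr rfl fun i _ => Finset.sum_congr rfl fun a _ =>
    Finset.sum_congr rfl fun j _ => by ring

/-- Quadratic form bounds for `∇²f(x) + α (1 - 𝕎) + ε`. -/
lemma penalizedHess_quadratic_bounds {W : Matrix (Fin N) (Fin N) ℝ} (hW : W.IsSymm)
    (hnonneg : ∀ i j, 0 ≤ W i j) (hrow : ∀ i, ∑ j, W i j = 1) {m M : ℝ}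
    {HF : Fin N → EuclideanSpace ℝ (Fin n) → Matrix (Fin n) (Fin n) ℝ}
    (hlow : ∀ i y, (HF i y - m • (1 : Matrix (Fin n) (Fin n) ℝ)).PosSemidef)
    (hup : ∀ i y, (M • (1 : Matrix (Fin n) (Fin n) ℝ) - HF i y).PosSemidef)
    {α ε : ℝ} (hα : 0 ≤ α) (x : EuclideanSpace ℝ (Fin N × Fin n)) (v : Fin N × Fin n → ℝ) :
    (m + ε) * ∑ p, v p ^ 2 ≤ v ⬝ᵥ (blockHess N n HF x
      + α • ((1 : Matrix (Fin N × Fin n) (Fin N × Fin n) ℝ) - WW N n W) + ε • 1).mulVec v ∧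
    v ⬝ᵥ (blockHess N n HF x
      + α • ((1 : Matrix (Fin N × Fin n) (Fin N × Fin n) ℝ) - WW N n W) + ε • 1).mulVec v ≤
      ∑ p, (M + ε + 2 * (α * (1 - W p.1 p.1))) * v p ^ 2 := by
  have e : v ⬝ᵥ v = ∑ p, v p ^ 2 := Finset.sum_congr rfl fun i _ => by ring
  have hq : v ⬝ᵥ (blockHess N n HF x
      + α • ((1 : Matrix (Fin N × Fin n) (Fin N × Fin n) ℝ) - WW N n W) + ε • 1).mulVec v =
      v ⬝ᵥ (blockHess N n HF x).mulVec v +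
        α * (∑ p, v p ^ 2 - v ⬝ᵥ (WW N n W).mulVec v) + ε * ∑ p, v p ^ 2 := by
    simp only [Matrix.add_mulVec, Matrix.sub_mulVec, Matrix.smul_mulVec, Matrix.one_mulVec,
      dotProduct_add, dotProduct_sub, dotProduct_smul, smul_eq_mul, e]
  have hL : 0 ≤ ∑ p, v p ^ 2 - v ⬝ᵥ (WW N n W).mulVec v ∧
      ∑ p, v p ^ 2 - v ⬝ᵥ (WW N n W).mulVec v ≤ ∑ p, 2 * (1 - W p.1 p.1) * v p ^ 2 := by
    rw [dotProduct_WW_mulVec, Fintype.sum_prod_type_right, Fintype.sum_prod_type_right,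
      ← Finset.sum_sub_distrib]
    have h := fun a : Fin n => stochastic_quadratic_bounds hW hnonneg hrow (fun i => v (i, a))
    exact ⟨Finset.sum_nonneg fun a _ => (h a).1, Finset.sum_le_sum fun a _ => (h a).2⟩
  have hB : m * ∑ p, v p ^ 2 ≤ v ⬝ᵥ (blockHess N n HF x).mulVec v ∧
      v ⬝ᵥ (blockHess N n HF x).mulVec v ≤ M * ∑ p, v p ^ 2 := by
    rw [dotProduct_blockHess_mulVec, Fintype.sum_prod_type, Finset.mul_sum, Finset.mul_sum]
    have h := fun i : Fin N => posSemidef_quadratic_bounds (hlow i (comp N n x i))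
      (hup i (comp N n x i)) (fun a => v (i, a))
    exact ⟨Finset.sum_le_sum fun i _ => (h i).1, Finset.sum_le_sum fun i _ => (h i).2⟩
  rw [hq]
  refine ⟨by nlinarith [mul_nonneg hα hL.1], ?_⟩
  have hs : ∑ p : Fin N × Fin n, (M + ε + 2 * (α * (1 - W p.1 p.1))) * v p ^ 2 =
      M * ∑ p, v p ^ 2 + α * ∑ p : Fin N × Fin n, 2 * (1 - W p.1 p.1) * v p ^ 2
        + ε * ∑ p, v p ^ 2 := by
    simp only [Finset.mul_sum, ← Finset.sum_add_distrib]
    exact Finset.sum_congr rfl fun i _ => by ring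
  rw [hs]
  have := mul_le_mul_of_nonneg_left hL.2 hα
  linarith [hB.2]

lemma penalizedHess_isSymm {W : Matrix (Fin N) (Fin N) ℝ} (hW : W.IsSymm)
    {HF : Fin N → EuclideanSpace ℝ (Fin n) → Matrix (Fin n) (Fin n) ℝ}
    (hHF : ∀ i y, (HF i y).IsSymm) (α ε : ℝ) (x : EuclideanSpace ℝ (Fin N × Fin n)) :
    (blockHess N n HF x
      + α • ((1 : Matrix (Fin N × Fin n) (Fin N × Fin n) ℝ) - WW N n W) + ε • 1).IsSymm := by
  have hb : (blockHess N n HF x).IsSymm := by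
    ext p q
    simp only [Matrix.transpose_apply, blockHess, Matrix.of_apply]
    by_cases h : p.1 = q.1
    · rw [if_pos h, if_pos h.symm, h, (hHF _ _).apply]
    · rw [if_neg h, if_neg (Ne.symm h)]
  have hw : (WW N n W).IsSymm := by
    ext p q
    simp only [Matrix.transpose_apply, WW, Matrix.kroneckerMap_apply, hW.apply,
      Matrix.isSymm_one.apply]
  exact (hb.add ((Matrix.isSymm_one.sub hw).smul α)).add (Matrix.isSymm_one.smul ε)

end Network

/-- Geometric decay below a threshold after logarithmically many steps. -/
lemma mul_pow_le_of_log_div_log_le {c η σ : ℝ} (hc : 0 < c) (hη : 0 < η) (hσ : 0 < σ)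
    (hσ1 : σ < 1) {k : ℕ} (hk : Real.log (c / η) / Real.log (1 / σ) ≤ k) : c * σ ^ k ≤ η := by
  rw [div_le_iff₀ (Real.log_pos (one_lt_one_div hσ hσ1)), ← Real.log_pow] at hk
  have h := (Real.log_le_log_iff (by positivity) (by positivity)).1 hk
  rw [one_div, inv_pow, div_le_iff₀ hη, ← div_eq_inv_mul, le_div_iff₀ (by positivity)] at h
  exact h

theorem stmt14
    (N n : ℕ) (hN : 1 ≤ N) (hn : 1 ≤ n)
    (W : Matrix (Fin N) (Fin N) ℝ)
    (hWsymm : W.IsSymm)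
    (hWnonneg : ∀ i j, 0 ≤ W i j)
    (hWrow : ∀ i, ∑ j, W i j = 1)
    (hWcol : ∀ j, ∑ i, W i j = 1)
    (hWdiagpos : ∀ i, 0 < W i i)
    (m M : ℝ) (hm : 0 < m) (hmM : m ≤ M)
    (F : Fin N → EuclideanSpace ℝ (Fin n) → ℝ)
    (hFsmooth : ∀ i, ContDiff ℝ 2 (F i))
    (HF : Fin N → EuclideanSpace ℝ (Fin n) → Matrix (Fin n) (Fin n) ℝ)
    (hHF : ∀ i y, HasFDerivAt (gradient (F i)) (Matrix.toEuclideanCLM (𝕜 := ℝ) (HF i y)) y)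
    (hHFlow : ∀ i y, (HF i y - m • (1 : Matrix (Fin n) (Fin n) ℝ)).PosSemidef)
    (hHFup : ∀ i y, (M • (1 : Matrix (Fin n) (Fin n) ℝ) - HF i y).PosSemidef)
    (α ε : ℝ) (hα : 0 < α) (hε : 0 < ε)
    (x : EuclideanSpace ℝ (Fin N × Fin n))
    (H : Matrix (Fin N × Fin n) (Fin N × Fin n) ℝ)
    (hH : H = blockHess N n HF x
      + α • ((1 : Matrix (Fin N × Fin n) (Fin N × Fin n) ℝ) - WW N n W) + ε • 1)
    (D G : Matrix (Fin N × Fin n) (Fin N × Fin n) ℝ)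
    (hD : D = Matrix.diagonal (fun p => H p p))
    (hG : G = D - H)
    (wd wm : ℝ) (hwd : wd = ⨆ i, W i i) (hwm : wm = ⨅ i, W i i)
    (γ : ℝ) (hγpos : 0 < γ)
    (hγlt : γ < 2 * (m + α * (1 - wd) + ε) / (M + ε + α * (1 - wm) + α * (1 - wd)))
    (Tγ : Matrix (Fin N × Fin n) (Fin N × Fin n) ℝ)
    (hTγ : Tγ = γ • (D⁻¹ * G) + (1 - γ) • 1)
    (hσpos : 0 < specRad Tγ)
    (g : EuclideanSpace ℝ (Fin N × Fin n))
    (dseq : ℕ → EuclideanSpace ℝ (Fin N × Fin n))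
    (hd0 : dseq 0 = 0)
    (hrec : ∀ ℓ : ℕ, dseq (ℓ + 1) = mApp Tγ (dseq ℓ) - γ • mApp D⁻¹ g)
    (c : ℝ)
    (hc : c = ((M + 2 * α + ε) / (m + ε))
      * Real.sqrt ((ε + M + α * (1 - wm)) / (ε + m + α * (1 - wd)))) :
    ∀ η : ℝ, 0 < η → ∀ ℓ : ℕ,
      Real.log (c / η) / Real.log (1 / specRad Tγ) ≤ (ℓ : ℝ) →
      ‖mApp H (dseq ℓ) + g‖ ≤ η * ‖g‖ := by
  intro η hη ℓ hℓ
  have : Nonempty (Fin N) := ⟨⟨0, hN⟩⟩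
  have : Nonempty (Fin n) := ⟨⟨0, hn⟩⟩
  have hle_wd : ∀ i, W i i ≤ wd := fun i => by
    rw [hwd]; exact le_ciSup (f := fun i => W i i) (Set.finite_range _).bddAbove i
  have hwm_le : ∀ i, wm ≤ W i i := fun i => by
    rw [hwm]; exact ciInf_le (f := fun i => W i i) (Set.finite_range _).bddBelow i
  have hwd1 : wd ≤ 1 := by
    rw [hwd]
    refine ciSup_le fun i => ?_
    rw [← hWrow i]
    exact Finset.single_le_sum (fun j _ => hWnonneg i j) (Finset.mem_univ i)
  have ha : 0 ≤ α * (1 - wd) := mul_nonneg hα.le (by linarith)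
  have hau : ∀ i, α * (1 - wd) ≤ α * (1 - W i i) := fun i => by
    have := hle_wd i; gcongr
  have hub : ∀ i, α * (1 - W i i) ≤ α * (1 - wm) := fun i => by
    have := hwm_le i; gcongr
  have hab : α * (1 - wd) ≤ α * (1 - wm) :=
    (hau (Classical.arbitrary _)).trans (hub _)
  have hHFsymm : ∀ i y, (HF i y).IsSymm := fun i y => by
    have h := (hHFlow i y).isHermitian.add
      (Matrix.isHermitian_one.smul (IsSelfAdjoint.all m))
    rw [sub_add_cancel] at h
    simpa [Matrix.IsHermitian, Matrix.IsSymm] using h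
  have hdiag : ∀ p, H p p = HF p.1 (comp N n x p.1) p.2 p.2 + α * (1 - W p.1 p.1) + ε := by
    intro p
    simp [hH, blockHess, WW]
  have hHFdiag : ∀ i y a, m ≤ HF i y a a ∧ HF i y a a ≤ M := fun i y a => by
    have h1 := (hHFlow i y).diag_nonneg (i := a)
    have h2 := (hHFup i y).diag_nonneg (i := a)
    simp only [Matrix.sub_apply, Matrix.smul_apply, Matrix.one_apply_eq, smul_eq_mul,
      mul_one] at h1 h2
    constructor <;> linarith
  have hdlow : ∀ p, m + ε + α * (1 - W p.1 p.1) ≤ H p p := fun p => by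
    rw [hdiag]; linarith [(hHFdiag p.1 (comp N n x p.1) p.2).1]
  have hquad := penalizedHess_quadratic_bounds (ε := ε) hWsymm hWnonneg hWrow hHFlow hHFup hα.le x
  rw [← hH] at hquad
  have hγstep : ∀ p : Fin N × Fin n,
      γ * (M + ε + 2 * (α * (1 - W p.1 p.1))) < 2 * H p p := by
    intro p
    refine lt_of_lt_of_le ?_ (mul_le_mul_of_nonneg_left (hdlow p) zero_le_two)
    have h1 := hau p.1
    have h2 := hub p.1
    generalize α * (1 - W p.1 p.1) = t at h1 h2 ⊢
    generalize α * (1 - wd) = r at *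
    generalize α * (1 - wm) = s at *
    have hden : 0 < M + ε + s + r := by linarith
    have hnum : 0 < M + ε + 2 * t := by linarith
    rw [lt_div_iff₀ hden] at hγlt
    have hcross : (m + r + ε) * (M + ε + 2 * t) ≤ (m + ε + t) * (M + ε + s + r) := by
      have e1 := mul_nonneg (by linarith : 0 ≤ m + ε) (sub_nonneg.2 h2)
      have e2 := mul_nonneg (sub_nonneg.2 hmM) (sub_nonneg.2 h1)
      have e3 := mul_nonneg (ha.trans h1) (sub_nonneg.2 hab)
      linarith
    have := mul_lt_mul_of_pos_right hγlt hnum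
    refine lt_of_mul_lt_mul_right ?_ hden.le
    linarith
  have hsq : ∀ v : Fin N × Fin n → ℝ, v ≠ 0 → ∃ p, 0 < v p ^ 2 := fun v hv => by
    obtain ⟨p, hp⟩ := Function.ne_iff.1 hv
    exact ⟨p, sq_pos_of_ne_zero hp⟩
  have hpos : ∀ v : Fin N × Fin n → ℝ, v ≠ 0 → 0 < v ⬝ᵥ H.mulVec v := fun v hv => by
    obtain ⟨p, hp⟩ := hsq v hv
    refine lt_of_lt_of_le (mul_pos (by linarith) ?_) (hquad v).1
    exact Finset.sum_pos' (fun q _ => sq_nonneg _) ⟨p, Finset.mem_univ p, hp⟩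
  have hlt : ∀ v : Fin N × Fin n → ℝ, v ≠ 0 →
      γ * (v ⬝ᵥ H.mulVec v) < 2 * ∑ p, H p p * v p ^ 2 := fun v hv => by
    obtain ⟨p, hp⟩ := hsq v hv
    refine (mul_le_mul_of_nonneg_left (hquad v).2 hγpos.le).trans_lt ?_
    rw [Finset.mul_sum, Finset.mul_sum]
    simp only [← mul_assoc]
    refine Finset.sum_lt_sum (fun q _ => ?_) ⟨p, Finset.mem_univ p, ?_⟩
    · have := (hγstep q).le
      simp only [← mul_assoc] at this
      exact mul_le_mul_of_nonneg_right this (sq_nonneg _)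
    · have := hγstep p
      simp only [← mul_assoc] at this
      exact mul_lt_mul_of_pos_right this hp
  have hapos : 0 < ε + m + α * (1 - wd) := by linarith
  have hdpos : ∀ p, 0 < H p p := fun p => by linarith [hdlow p, hau p.1]
  have hT : Tγ = 1 - γ • ((Matrix.diagonal fun p => H p p)⁻¹ * H) := by
    have hu : IsUnit D.det := by
      rw [hD, Matrix.det_diagonal, isUnit_iff_ne_zero]
      exact Finset.prod_ne_zero_iff.2 fun p _ => (hdpos p).ne'
    rw [hTγ, hG, Matrix.mul_sub, Matrix.nonsing_inv_mul D hu, ← hD]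
    module
  rw [hD] at hrec
  obtain ⟨hσ1, hres⟩ := relaxedJacobi_residual (b := ε + M + α * (1 - wm))
    (hH ▸ penalizedHess_isSymm hWsymm hHFsymm α ε x) hpos hapos
    (fun p => by linarith [hdlow p, hau p.1])
    (fun p => by
      rw [hdiag]; linarith [(hHFdiag p.1 (comp N n x p.1) p.2).2, hub p.1])
    hγpos hlt hT hd0 hrec
  have hsqrt : 0 < Real.sqrt ((ε + M + α * (1 - wm)) / (ε + m + α * (1 - wd))) :=
    Real.sqrt_pos.2 (div_pos (by linarith) hapos)
  have hratio : 1 ≤ (M + 2 * α + ε) / (m + ε) := by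
    rw [one_le_div (by linarith)]; linarith
  have hsc : Real.sqrt ((ε + M + α * (1 - wm)) / (ε + m + α * (1 - wd))) ≤ c := by
    rw [hc]; exact le_mul_of_one_le_left hsqrt.le hratio
  refine (hres ℓ).trans (mul_le_mul_of_nonneg_right ?_ (norm_nonneg _))
  refine (mul_le_mul_of_nonneg_right hsc (by positivity)).trans ?_
  exact mul_pow_le_of_log_div_log_le (hsqrt.trans_le hsc) hη hσpos hσ1 hℓ
end

section
/- ‖𝔻_E^{-1} 𝔹‖_b ≤ 2α(1 − w) / (2α(1 − w) + ε + m) < 1. -/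
open scoped Kronecker RealInnerProductSpace
open Filter Topology

/-- A real matrix bounded below by `k > 0` in the Loewner order is positive definite. -/
lemma posDef_of_sub_smul_one_posSemidef {ι : Type*} [Fintype ι] [DecidableEq ι]
    {A : Matrix ι ι ℝ} {k : ℝ} (hk : 0 < k)
    (hA : (A - k • (1 : Matrix ι ι ℝ)).PosSemidef) : A.PosDef := by
  have h := Matrix.PosDef.posSemidef_add hA ((Matrix.PosDef.one (n := ι) (R := ℝ)).smul hk)
  simpa using h

/-- A real matrix bounded below by `k` in the Loewner order expands norms by at least `k`. -/
lemma mul_norm_le_norm_toEuclideanCLM {ι : Type*} [Fintype ι] [DecidableEq ι]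
    {A : Matrix ι ι ℝ} {k : ℝ} (hA : (A - k • (1 : Matrix ι ι ℝ)).PosSemidef)
    (v : EuclideanSpace ℝ ι) : k * ‖v‖ ≤ ‖Matrix.toEuclideanCLM (𝕜 := ℝ) A v‖ := by
  have h : 0 ≤ ⟪v, Matrix.toEuclideanCLM (𝕜 := ℝ) (A - k • 1) v⟫ := by
    have h := hA.dotProduct_mulVec_nonneg v.ofLp
    rw [EuclideanSpace.inner_eq_star_dotProduct, Matrix.ofLp_toEuclideanCLM, dotProduct_comm]
    exact h
  have hsub : Matrix.toEuclideanCLM (𝕜 := ℝ) (A - k • 1) v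
      = Matrix.toEuclideanCLM (𝕜 := ℝ) A v - k • v := by
    simp
  rw [hsub, inner_sub_right, inner_smul_right, real_inner_self_eq_norm_sq] at h
  have hcs := real_inner_le_norm v (Matrix.toEuclideanCLM (𝕜 := ℝ) A v)
  rcases (norm_nonneg v).eq_or_lt with hv | hv
  · simp [← hv]
  · nlinarith

/-- The inverse of a real matrix bounded below by `k > 0` has spectral norm at most `k⁻¹`. -/
lemma specNorm_inv_le {ι : Type*} [Fintype ι] [DecidableEq ι]
    {A : Matrix ι ι ℝ} {k : ℝ} (hk : 0 < k)
    (hA : (A - k • (1 : Matrix ι ι ℝ)).PosSemidef) : specNorm A⁻¹ ≤ k⁻¹ := by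
  refine ContinuousLinearMap.opNorm_le_bound _ (by positivity) fun v => ?_
  have hunit : IsUnit A.det :=
    (Matrix.isUnit_iff_isUnit_det A).1 (posDef_of_sub_smul_one_posSemidef hk hA).isUnit
  have h := mul_norm_le_norm_toEuclideanCLM hA (Matrix.toEuclideanCLM (𝕜 := ℝ) A⁻¹ v)
  rw [← mul_apply_eq_comp, ← map_mul, Matrix.mul_nonsing_inv A hunit, map_one,
    one_apply_eq_self] at h
  rwa [inv_mul_eq_div, le_div_iff₀' hk]

lemma specNorm_smul {ι : Type*} [Fintype ι] [DecidableEq ι] (c : ℝ) (A : Matrix ι ι ℝ) :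
    specNorm (c • A) = |c| * specNorm A := by
  simp [specNorm, norm_smul]

/-- The block-diagonal matrix with diagonal blocks `A i`. -/
def blockDiag {ι κ : Type*} [DecidableEq ι] (A : ι → Matrix κ κ ℝ) :
    Matrix (ι × κ) (ι × κ) ℝ :=
  Matrix.of fun p q => if p.1 = q.1 then A p.1 p.2 q.2 else 0

lemma blockDiag_mul {ι κ : Type*} [Fintype ι] [Fintype κ] [DecidableEq ι]
    (A A' : ι → Matrix κ κ ℝ) :
    blockDiag A * blockDiag A' = blockDiag fun i => A i * A' i := by
  ext ⟨i, a⟩ ⟨j, b⟩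
  by_cases hij : i = j
  · subst hij
    simp [blockDiag, Matrix.mul_apply, Fintype.sum_prod_type, Finset.sum_ite_irrel]
  · simp [blockDiag, Matrix.mul_apply, Fintype.sum_prod_type, Finset.sum_ite_irrel, hij]

lemma blockDiag_one {ι κ : Type*} [DecidableEq ι] [DecidableEq κ] :
    blockDiag (fun _ : ι => (1 : Matrix κ κ ℝ)) = 1 := by
  ext ⟨i, a⟩ ⟨j, b⟩
  by_cases hij : i = j <;> simp [blockDiag, Matrix.one_apply, hij]

lemma blockDiag_inv {ι κ : Type*} [Fintype ι] [Fintype κ] [DecidableEq ι] [DecidableEq κ]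
    {A : ι → Matrix κ κ ℝ} (hA : ∀ i, IsUnit (A i).det) :
    (blockDiag A)⁻¹ = blockDiag fun i => (A i)⁻¹ := by
  refine Matrix.inv_eq_right_inv ?_
  simp only [blockDiag_mul, Matrix.mul_nonsing_inv _ (hA _), blockDiag_one]

/-- The blocks of `diag(A) (C ⊗ I)` are `C i j • A i`. -/
lemma block_blockDiag_mul_kronecker_one {ι κ : Type*} [Fintype ι] [Fintype κ] [DecidableEq ι]
    [DecidableEq κ] (A : ι → Matrix κ κ ℝ) (C : Matrix ι ι ℝ) (i j : ι) :
    (Matrix.of fun a b => (blockDiag A * (C ⊗ₖ (1 : Matrix κ κ ℝ))) (i, a) (j, b))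
      = C i j • A i := by
  ext a b
  simp [blockDiag, Matrix.mul_apply, Fintype.sum_prod_type, Matrix.one_apply,
    mul_comm]

theorem stmt15
    (N n : ℕ) (hN : 1 ≤ N) (hn : 1 ≤ n)
    (W : Matrix (Fin N) (Fin N) ℝ)
    (hWsymm : W.IsSymm)
    (hWnonneg : ∀ i j, 0 ≤ W i j)
    (hWrow : ∀ i, ∑ j, W i j = 1)
    (hWcol : ∀ j, ∑ i, W i j = 1)
    (hWdiagpos : ∀ i, 0 < W i i)
    (w : ℝ) (hw0 : 0 < w) (hw1 : w < 1) (hWdiagEq : ∀ i, W i i = w)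
    (m M : ℝ) (hm : 0 < m) (hmM : m ≤ M)
    (F : Fin N → EuclideanSpace ℝ (Fin n) → ℝ)
    (hFsmooth : ∀ i, ContDiff ℝ 2 (F i))
    (HF : Fin N → EuclideanSpace ℝ (Fin n) → Matrix (Fin n) (Fin n) ℝ)
    (hHF : ∀ i y, HasFDerivAt (gradient (F i)) (Matrix.toEuclideanCLM (𝕜 := ℝ) (HF i y)) y)
    (hHFlow : ∀ i y, (HF i y - m • (1 : Matrix (Fin n) (Fin n) ℝ)).PosSemidef)
    (hHFup : ∀ i y, (M • (1 : Matrix (Fin n) (Fin n) ℝ) - HF i y).PosSemidef)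
    (α ε : ℝ) (hα : 0 < α) (hε : 0 < ε)
    (x : EuclideanSpace ℝ (Fin N × Fin n))
    (DE B : Matrix (Fin N × Fin n) (Fin N × Fin n) ℝ)
    (hDE : DE = blockHess N n HF x
      + (2 * α * (1 - w)) • (1 : Matrix (Fin N × Fin n) (Fin N × Fin n) ℝ) + ε • 1)
    (hB : B = α • (WW N n W + (1 - 2 * w) • (1 : Matrix (Fin N × Fin n) (Fin N × Fin n) ℝ)))
 :
    blockNorm (DE⁻¹ * B) ≤ 2 * α * (1 - w) / (2 * α * (1 - w) + ε + m) ∧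
    2 * α * (1 - w) / (2 * α * (1 - w) + ε + m) < 1 := by
  have hw : 0 < 2 * α * (1 - w) := by
    have : 0 < 1 - w := by linarith
    positivity
  have hk : 0 < 2 * α * (1 - w) + ε + m := by positivity
  refine ⟨?_, by rw [div_lt_one hk]; linarith⟩
  set c := 2 * α * (1 - w) + ε with hc
  let A : Fin N → Matrix (Fin n) (Fin n) ℝ := fun i => HF i (comp N n x i) + c • 1
  have hA (i : Fin N) : (A i - (c + m) • (1 : Matrix (Fin n) (Fin n) ℝ)).PosSemidef := by
    have h : A i - (c + m) • (1 : Matrix (Fin n) (Fin n) ℝ)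
        = HF i (comp N n x i) - m • 1 := by
      simp only [A, add_smul]
      abel
    rw [h]
    exact hHFlow i _
  have hunit (i : Fin N) : IsUnit (A i).det :=
    (Matrix.isUnit_iff_isUnit_det _).1 (posDef_of_sub_smul_one_posSemidef hk (hA i)).isUnit
  have hDE' : DE = blockDiag A := by
    rw [hDE]
    ext ⟨i, a⟩ ⟨j, b⟩
    by_cases hij : i = j
    · subst hij
      by_cases hab : a = b <;> simp [blockHess, blockDiag, A, hab, hc, add_assoc]
    · simp [blockHess, blockDiag, hij]
  let C : Matrix (Fin N) (Fin N) ℝ := α • (W + (1 - 2 * w) • 1)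
  have hB' : B = C ⊗ₖ (1 : Matrix (Fin n) (Fin n) ℝ) := by
    rw [hB, WW, Matrix.smul_kronecker, Matrix.add_kronecker, Matrix.smul_kronecker,
      Matrix.one_kronecker_one]
  have hC (i j : Fin N) : 0 ≤ C i j := by
    refine mul_nonneg hα.le ?_
    by_cases hij : i = j
    · subst hij
      simp only [Matrix.add_apply, Matrix.smul_apply, Matrix.one_apply_eq, hWdiagEq, smul_eq_mul]
      linarith
    · simpa [hij] using hWnonneg i j
  have hCrow (i : Fin N) : ∑ j, C i j = 2 * α * (1 - w) := by
    simp only [C, Matrix.smul_apply, Matrix.add_apply, smul_eq_mul, ← Finset.mul_sum,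
      Finset.sum_add_distrib, hWrow, Matrix.one_apply, Finset.sum_ite_eq, Finset.mem_univ, if_true]
    ring
  have : Nonempty (Fin N) := ⟨⟨0, hN⟩⟩
  refine ciSup_le fun i => ?_
  rw [hDE', hB', blockDiag_inv hunit]
  simp only [block_blockDiag_mul_kronecker_one, specNorm_smul, abs_of_nonneg (hC _ _)]
  rw [← Finset.sum_mul, hCrow, div_eq_mul_inv]
  exact mul_le_mul_of_nonneg_left (specNorm_inv_le hk (hA i)) hw.le
end

section
/- ‖𝔻^{-1} 𝔾‖_b ≤ (M − m + α(1 − w)) / (α(1 − w) + ε + m); moreover, if ε > max{M − 2m, 0}, then (M − m + α(1 − w)) / (α(1 − w) + ε + m) < 1. -/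
open scoped Kronecker RealInnerProductSpace
open Filter Topology

open scoped Matrix.Norms.L2Operator in
lemma specNorm_eq_l2_opNorm {ι : Type*} [Fintype ι] [DecidableEq ι] (A : Matrix ι ι ℝ) :
    specNorm A = ‖A‖ := rfl

open scoped Matrix.Norms.L2Operator in
lemma specNorm_mul_le {ι : Type*} [Fintype ι] [DecidableEq ι] (A B : Matrix ι ι ℝ) :
    specNorm (A * B) ≤ specNorm A * specNorm B := by
  simpa only [specNorm_eq_l2_opNorm] using norm_mul_le A B

open scoped Matrix.Norms.L2Operator in
lemma specNorm_diagonal_le {ι : Type*} [Fintype ι] [DecidableEq ι] {v : ι → ℝ} {c : ℝ}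
    (hc : 0 ≤ c) (hv : ∀ i, |v i| ≤ c) : specNorm (Matrix.diagonal v) ≤ c := by
  rw [specNorm_eq_l2_opNorm, Matrix.l2_opNorm_diagonal]
  exact (pi_norm_le_iff_of_nonneg hc).2 hv

lemma specNorm_nonneg {ι : Type*} [Fintype ι] [DecidableEq ι] (A : Matrix ι ι ℝ) :
    0 ≤ specNorm A := norm_nonneg _

lemma specNorm_smul_one_le {ι : Type*} [Fintype ι] [DecidableEq ι] {c : ℝ} (hc : 0 ≤ c) :
    specNorm (c • (1 : Matrix ι ι ℝ)) ≤ c := by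
  rw [Matrix.smul_one_eq_diagonal]
  exact specNorm_diagonal_le hc fun _ => (abs_of_nonneg hc).le

lemma specNorm_le_of_posSemidef {ι : Type*} [Fintype ι] [DecidableEq ι] {A : Matrix ι ι ℝ}
    {c : ℝ} (hc : 0 ≤ c) (hsub : (c • (1 : Matrix ι ι ℝ) - A).PosSemidef)
    (hadd : (c • (1 : Matrix ι ι ℝ) + A).PosSemidef) : specNorm A ≤ c := by
  have hA : A.IsHermitian := by
    simpa [Matrix.IsHermitian] using hsub.isHermitian
  have hsymm : (Matrix.toEuclideanCLM (𝕜 := ℝ) A).IsSymmetric :=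
    Matrix.isSymmetric_toEuclideanLin_iff.2 hA
  rw [specNorm, ContinuousLinearMap.norm_eq_iSup_rayleighQuotient _ hsymm]
  refine Real.iSup_le (fun x => ?_) hc
  have hnorm : (x.ofLp ⬝ᵥ x.ofLp) = ‖x‖ ^ 2 := by
    rw [← real_inner_self_eq_norm_sq, PiLp.inner_apply]
    simp [dotProduct, sq]
  have h1 := hsub.dotProduct_mulVec_nonneg x.ofLp
  have h2 := hadd.dotProduct_mulVec_nonneg x.ofLp
  simp only [star_trivial, Matrix.sub_mulVec, Matrix.add_mulVec, Matrix.smul_mulVec,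
    Matrix.one_mulVec, dotProduct_sub, dotProduct_add, dotProduct_smul, smul_eq_mul, hnorm]
    at h1 h2
  rw [ContinuousLinearMap.rayleighQuotient, abs_div, abs_of_nonneg (sq_nonneg ‖x‖)]
  refine div_le_of_le_mul₀ (sq_nonneg _) hc ?_
  rw [ContinuousLinearMap.reApplyInnerSelf_apply, real_inner_comm, Matrix.inner_toEuclideanCLM]
  simp only [RCLike.re_to_real]
  rw [abs_le]
  constructor <;> linarith

lemma le_diag_of_posSemidef {ι : Type*} [DecidableEq ι] {A : Matrix ι ι ℝ} {m : ℝ}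
    (h : (A - m • (1 : Matrix ι ι ℝ)).PosSemidef) (i : ι) : m ≤ A i i := by
  have := h.diag_nonneg (i := i)
  simp at this
  linarith

lemma diag_le_of_posSemidef {ι : Type*} [DecidableEq ι] {A : Matrix ι ι ℝ} {M : ℝ}
    (h : (M • (1 : Matrix ι ι ℝ) - A).PosSemidef) (i : ι) : A i i ≤ M := by
  have := h.diag_nonneg (i := i)
  simp at this
  linarith

lemma specNorm_diagonal_sub_self_le {ι : Type*} [Fintype ι] [DecidableEq ι] {A : Matrix ι ι ℝ}
    {m M : ℝ} (hmM : m ≤ M) (hlow : (A - m • (1 : Matrix ι ι ℝ)).PosSemidef)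
    (hup : (M • (1 : Matrix ι ι ℝ) - A).PosSemidef) :
    specNorm (Matrix.diagonal (fun i => A i i) - A) ≤ M - m := by
  have hM : (Matrix.diagonal fun i => M - A i i).PosSemidef :=
    .diagonal fun i => sub_nonneg.2 (diag_le_of_posSemidef hup i)
  have hm : (Matrix.diagonal fun i => A i i - m).PosSemidef :=
    .diagonal fun i => sub_nonneg.2 (le_diag_of_posSemidef hlow i)
  refine specNorm_le_of_posSemidef (sub_nonneg.2 hmM) ?_ ?_
  · convert hM.add hlow using 1
    simp only [Matrix.smul_one_eq_diagonal, ← Matrix.diagonal_sub]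
    abel
  · convert hm.add hup using 1
    simp only [Matrix.smul_one_eq_diagonal, ← Matrix.diagonal_sub]
    abel

theorem stmt16
    (N n : ℕ) (hN : 1 ≤ N) (hn : 1 ≤ n)
    (W : Matrix (Fin N) (Fin N) ℝ)
    (hWsymm : W.IsSymm)
    (hWnonneg : ∀ i j, 0 ≤ W i j)
    (hWrow : ∀ i, ∑ j, W i j = 1)
    (hWcol : ∀ j, ∑ i, W i j = 1)
    (hWdiagpos : ∀ i, 0 < W i i)
    (w : ℝ) (hw0 : 0 < w) (hw1 : w < 1) (hWdiagEq : ∀ i, W i i = w)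
    (m M : ℝ) (hm : 0 < m) (hmM : m ≤ M)
    (F : Fin N → EuclideanSpace ℝ (Fin n) → ℝ)
    (hFsmooth : ∀ i, ContDiff ℝ 2 (F i))
    (HF : Fin N → EuclideanSpace ℝ (Fin n) → Matrix (Fin n) (Fin n) ℝ)
    (hHF : ∀ i y, HasFDerivAt (gradient (F i)) (Matrix.toEuclideanCLM (𝕜 := ℝ) (HF i y)) y)
    (hHFlow : ∀ i y, (HF i y - m • (1 : Matrix (Fin n) (Fin n) ℝ)).PosSemidef)
    (hHFup : ∀ i y, (M • (1 : Matrix (Fin n) (Fin n) ℝ) - HF i y).PosSemidef)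
    (α ε : ℝ) (hα : 0 < α) (hε : 0 < ε)
    (x : EuclideanSpace ℝ (Fin N × Fin n))
    (H : Matrix (Fin N × Fin n) (Fin N × Fin n) ℝ)
    (hH : H = blockHess N n HF x
      + α • ((1 : Matrix (Fin N × Fin n) (Fin N × Fin n) ℝ) - WW N n W) + ε • 1)
    (D G : Matrix (Fin N × Fin n) (Fin N × Fin n) ℝ)
    (hD : D = Matrix.diagonal (fun p => H p p))
    (hG : G = D - H)
 :
    blockNorm (D⁻¹ * G) ≤ (M - m + α * (1 - w)) / (α * (1 - w) + ε + m) ∧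
    (ε > max (M - 2 * m) 0 → (M - m + α * (1 - w)) / (α * (1 - w) + ε + m) < 1) := by
  have hd : 0 < α * (1 - w) + ε + m := by
    have := mul_pos hα (sub_pos.2 hw1)
    linarith
  refine ⟨?_, fun h => ?_⟩
  · have hHdiag : ∀ p, H p p = HF p.1 (comp N n x p.1) p.2 p.2 + α * (1 - w) + ε := by
      intro p
      simp [hH, blockHess, WW, Matrix.kroneckerMap_apply, hWdiagEq]
    have hHge : ∀ p, α * (1 - w) + ε + m ≤ H p p := by
      intro p
      have := le_diag_of_posSemidef (hHFlow p.1 (comp N n x p.1)) p.2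
      rw [hHdiag]
      linarith
    have hHpos : ∀ p, 0 < H p p := fun p => hd.trans_le (hHge p)
    have hDinv : D⁻¹ = Matrix.diagonal (fun p => (H p p)⁻¹) := by
      refine Matrix.inv_eq_left_inv ?_
      simp [hD, Matrix.diagonal_mul_diagonal, (hHpos _).ne']
    have hGself : ∀ i, (Matrix.of fun a b : Fin n => G (i, a) (i, b)) =
        Matrix.diagonal (fun a => HF i (comp N n x i) a a) - HF i (comp N n x i) := by
      intro i
      ext a b
      rcases eq_or_ne a b with rfl | hab
      · simp [hG, hD]
      · simp [hG, hD, hH, blockHess, WW, Matrix.kroneckerMap_apply, hab]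
    have hGne : ∀ i j, i ≠ j → (Matrix.of fun a b : Fin n => G (i, a) (j, b)) =
        (α * W i j) • (1 : Matrix (Fin n) (Fin n) ℝ) := by
      intro i j hij
      ext a b
      simp [hG, hD, hH, blockHess, WW, Matrix.kroneckerMap_apply, hij, mul_assoc]
    have hGnorm : ∀ i j, specNorm (Matrix.of fun a b : Fin n => G (i, a) (j, b)) ≤
        α * W i j + if i = j then M - m - α * w else 0 := by
      intro i j
      rcases eq_or_ne i j with rfl | hij
      · rw [hGself, hWdiagEq, if_pos rfl, add_sub_cancel]
        exact specNorm_diagonal_sub_self_le hmM (hHFlow _ _) (hHFup _ _)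
      · rw [hGne i j hij, if_neg hij, add_zero]
        exact specNorm_smul_one_le (mul_nonneg hα.le (hWnonneg i j))
    have hblock : ∀ i j, (Matrix.of fun a b : Fin n => (D⁻¹ * G) (i, a) (j, b)) =
        Matrix.diagonal (fun a => (H (i, a) (i, a))⁻¹) *
          Matrix.of fun a b : Fin n => G (i, a) (j, b) := by
      intro i j
      ext a b
      simp [hDinv, Matrix.diagonal_mul]
    have hDnorm : ∀ i, specNorm (Matrix.diagonal fun a : Fin n => (H (i, a) (i, a))⁻¹) ≤
        (α * (1 - w) + ε + m)⁻¹ := by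
      intro i
      refine specNorm_diagonal_le (inv_nonneg.2 hd.le) fun a => ?_
      rw [abs_of_pos (inv_pos.2 (hHpos _))]
      exact inv_anti₀ hd (hHge _)
    have : Nonempty (Fin N) := ⟨⟨0, hN⟩⟩
    refine ciSup_le fun i => ?_
    calc ∑ j, specNorm (Matrix.of fun a b : Fin n => (D⁻¹ * G) (i, a) (j, b))
        ≤ ∑ j, (α * (1 - w) + ε + m)⁻¹ * (α * W i j + if i = j then M - m - α * w else 0) := by
          refine Finset.sum_le_sum fun j _ => ?_
          rw [hblock]
          exact (specNorm_mul_le _ _).trans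
            (mul_le_mul (hDnorm i) (hGnorm i j) (specNorm_nonneg _) (inv_nonneg.2 hd.le))
      _ = (M - m + α * (1 - w)) / (α * (1 - w) + ε + m) := by
          rw [← Finset.mul_sum, Finset.sum_add_distrib, ← Finset.mul_sum, hWrow,
            Finset.sum_ite_eq, if_pos (Finset.mem_univ i)]
          ring
  · rw [div_lt_one hd]
    have := (le_max_left (M - 2 * m) 0).trans_lt h
    linarith
end
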